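/- Let d be a positive integer, σ > 0, let V_0 be a real symmetric positive definite d×d matrix, and for each n = 1, …, N let z_{n,1}, …, z_{n,K_n} ∈ ℝ^d; define recursively V_n = V_{n-1} + σ^{-2} Σ_{k=1}^{K_n} z_{n,k} z_{n,k}ᵀ. Then log(det V_N / det V_0) ≥ Σ_{n=1}^N log(1 + σ^{-2} Σ_{k=1}^{K_n} z_{n,k}ᵀ V_{n-1}^{-1} z_{n,k}). -/

import Mathlib

open Matrix

/-- The Weierstrass product inequality for nonnegative terms. -/
theorem Finset.one_add_sum_le_prod_one_add {ι : Type*} (s : Finset ι) {f : ι → ℝ}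
    (hf : ∀ i ∈ s, 0 ≤ f i) : 1 + ∑ i ∈ s, f i ≤ ∏ i ∈ s, (1 + f i) := by
  classical
  induction s using Finset.induction_on with
  | empty => simp
  | insert a s ha ih =>
    rw [Finset.forall_mem_insert] at hf
    rw [Finset.sum_insert ha, Finset.prod_insert ha]
    nlinarith [ih hf.2, mul_nonneg hf.1 (Finset.sum_nonneg hf.2),
      mul_le_mul_of_nonneg_left (ih hf.2) hf.1]

namespace Matrix

variable {m κ : Type*} [Fintype m] [Fintype κ]

theorem IsHermitian.det_one_add_eq_prod_eigenvalues [DecidableEq m] {A : Matrix m m ℝ}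
    (hA : A.IsHermitian) :
    (1 + A).det = ∏ i, (1 + hA.eigenvalues i) := by
  have h := congrArg (Polynomial.eval (-1)) hA.charpoly_eq
  have hneg : scalar m (-1 : ℝ) - A = -(1 + A) := by
    rw [map_neg, map_one]
    abel
  have hfactor : ∀ i, -1 - hA.eigenvalues i = -1 * (1 + hA.eigenvalues i) := fun i => by ring
  rw [eval_charpoly, hneg, det_neg, Polynomial.eval_prod] at h
  simp only [Polynomial.eval_sub, Polynomial.eval_X, Polynomial.eval_C, RCLike.ofReal_real_eq_id,
    id_eq, hfactor, Finset.prod_mul_distrib, Finset.prod_const, Finset.card_univ] at h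
  exact mul_left_cancel₀ (pow_ne_zero _ (by norm_num)) h

theorem PosSemidef.one_add_trace_le_det_one_add [DecidableEq m] {A : Matrix m m ℝ}
    (hA : A.PosSemidef) :
    1 + A.trace ≤ (1 + A).det := by
  rw [hA.isHermitian.det_one_add_eq_prod_eigenvalues, hA.isHermitian.trace_eq_sum_eigenvalues]
  exact Finset.one_add_sum_le_prod_one_add _ fun i _ => hA.eigenvalues_nonneg i

theorem PosDef.add_smul_sum_vecMulVec {A : Matrix m m ℝ} (hA : A.PosDef) {c : ℝ} (hc : 0 ≤ c)
    (z : κ → m → ℝ) : (A + c • ∑ k, vecMulVec (z k) (z k)).PosDef :=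
  hA.add_posSemidef <| (posSemidef_sum _ fun k _ => by
    simpa using posSemidef_vecMulVec_self_star (z k)).smul hc

/-- A batch of rank-one updates multiplies the determinant by at least one plus the sum of the
corresponding quadratic forms. -/
theorem PosDef.det_mul_one_add_sum_le [DecidableEq m] {A : Matrix m m ℝ} (hA : A.PosDef)
    {c : ℝ} (hc : 0 ≤ c) (z : κ → m → ℝ) :
    A.det * (1 + c * ∑ k, z k ⬝ᵥ (A⁻¹ *ᵥ z k)) ≤
      (A + c • ∑ k, vecMulVec (z k) (z k)).det := by
  classical
  let Z : Matrix κ m ℝ := of z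
  have hgram : ∑ k, vecMulVec (z k) (z k) = Zᵀ * Z := by
    ext i j
    simp [Z, sum_apply, vecMulVec_apply, mul_apply]
  have hsum : ∑ k, z k ⬝ᵥ (A⁻¹ *ᵥ z k) = (Z * A⁻¹ * Zᵀ).trace := by
    refine Finset.sum_congr rfl fun k _ => ?_
    rw [diag_apply, Matrix.mul_assoc]
    simp [Z, mul_apply, dotProduct, mulVec]
  have hpsd : (c • (Z * A⁻¹ * Zᵀ)).PosSemidef := by
    have h := (hA.inv.posSemidef.mul_mul_conjTranspose_same Z).smul hc
    rwa [conjTranspose_eq_transpose_of_trivial] at h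
  have hfactor : A + c • (Zᵀ * Z) = A * (1 + (A⁻¹ * Zᵀ) * (c • Z)) := by
    rw [Matrix.mul_add, Matrix.mul_one, Matrix.mul_assoc,
      mul_nonsing_inv_cancel_left _ _ hA.det_pos.ne'.isUnit, Matrix.mul_smul]
  rw [hgram, hfactor, det_mul, det_one_add_mul_comm, hsum, Matrix.smul_mul, ← Matrix.mul_assoc]
  refine mul_le_mul_of_nonneg_left ?_ hA.det_pos.le
  simpa using hpsd.one_add_trace_le_det_one_add

end Matrix

/-- Telescoped lower bound on the posterior log-determinant.  Starting from a symmetric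
positive definite `V 0` and updating `V (n+1) = V n + σ⁻² ∑ₖ z n k (z n k)ᵀ` with the batch
of vectors observed in episode `n+1`, we have
`log (det (V N) / det (V 0)) ≥ ∑ₙ log (1 + σ⁻² ∑ₖ (z n k)ᵀ (V n)⁻¹ (z n k))`. -/
theorem log_det_ratio_ge_sum_log
    (d N : ℕ) (hd : 0 < d) (σ : ℝ) (hσ : 0 < σ)
    (K : ℕ → ℕ) (z : (n : ℕ) → Fin (K n) → (Fin d → ℝ))
    (V : ℕ → Matrix (Fin d) (Fin d) ℝ)
    (hV0 : (V 0).PosDef)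
    (hrec : ∀ n < N,
      V (n + 1) = V n + (σ ^ 2)⁻¹ • ∑ k, vecMulVec (z n k) (z n k)) :
    ∑ n ∈ Finset.range N,
        Real.log (1 + (σ ^ 2)⁻¹ * ∑ k, z n k ⬝ᵥ ((V n)⁻¹ *ᵥ z n k))
      ≤ Real.log ((V N).det / (V 0).det) := by
  have hc : 0 ≤ (σ ^ 2)⁻¹ := by positivity
  have hpos : ∀ n ≤ N, (V n).PosDef := by
    intro n
    induction n with
    | zero => exact fun _ => hV0
    | succ n ih =>
      intro hn
      rw [hrec n hn]
      exact (ih (Nat.le_of_succ_le hn)).add_smul_sum_vecMulVec hc (z n)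
  have hstep : ∀ n ∈ Finset.range N,
      Real.log (1 + (σ ^ 2)⁻¹ * ∑ k, z n k ⬝ᵥ ((V n)⁻¹ *ᵥ z n k)) ≤
        Real.log (V (n + 1)).det - Real.log (V n).det := by
    intro n hn
    have hn : n < N := Finset.mem_range.1 hn
    have hVn := hpos n hn.le
    have hquad : 0 ≤ ∑ k, z n k ⬝ᵥ ((V n)⁻¹ *ᵥ z n k) :=
      Finset.sum_nonneg fun k _ => by
        simpa using hVn.inv.posSemidef.dotProduct_mulVec_nonneg (z n k)
    have hone : 0 < 1 + (σ ^ 2)⁻¹ * ∑ k, z n k ⬝ᵥ ((V n)⁻¹ *ᵥ z n k) := by positivity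
    rw [← Real.log_div (hpos (n + 1) hn).det_pos.ne' hVn.det_pos.ne']
    refine Real.log_le_log hone ?_
    rw [le_div_iff₀' hVn.det_pos, hrec n hn]
    exact hVn.det_mul_one_add_sum_le hc (z n)
  rw [Real.log_div (hpos N le_rfl).det_pos.ne' hV0.det_pos.ne',
    ← Finset.sum_range_sub fun n => Real.log (V n).det]
  exact Finset.sum_le_sum hstep
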